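/- arXiv:2102.05314 — 2 statements merged into one kernel-verified Lean document; each statement's English description precedes it below -/
import Mathlib

section
/- Let W0 ∈ ℝ^{n×K} and H0 ∈ ℝ^{K×p} be nonnegative matrices such that W0 and W0_train have rank K and such that H0 and H0_T have linearly independent rows. Assume condition (A1): the nonnegative orthant {x ∈ ℝ^K : x ≥ 0 entrywise} is the only K-simplicial cone belonging to the union of the two sets {C : Cone(W0_train) ⊆ C ⊆ D(H0)} and {C : Cone(W0) ⊆ C ⊆ D(H0_T)}. Then for every pair of nonnegative matrices W ∈ ℝ^{n×K} of rank K and H ∈ ℝ^{K×p} with linearly independent rows satisfying T(W H) = T(W0 H0), one has (W,H) ≡ (W0,H0). -/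
open Matrix

noncomputable section

/-- Squared Frobenius norm `‖A‖_F²`. -/
def frobSq {m p : ℕ} (A : Matrix (Fin m) (Fin p) ℝ) : ℝ := ∑ i, ∑ j, (A i j) ^ 2

/-- Frobenius norm `‖A‖_F`. -/
def frobNorm {m p : ℕ} (A : Matrix (Fin m) (Fin p) ℝ) : ℝ := Real.sqrt (frobSq A)

/-- Euclidean norm `‖v‖₂` of a vector. -/
def eNorm {m : ℕ} (v : Fin m → ℝ) : ℝ := Real.sqrt (∑ i, (v i) ^ 2)

/-- Entrywise nonnegative matrix. -/
def Nonneg {m K : ℕ} (A : Matrix (Fin m) (Fin K) ℝ) : Prop := ∀ i k, 0 ≤ A i k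

/-- Row-stochastic matrix: nonnegative with unit row sums. -/
def RowStochastic {m K : ℕ} (W : Matrix (Fin m) (Fin K) ℝ) : Prop :=
  Nonneg W ∧ ∀ i, ∑ k, W i k = 1

/-- The mask operator `T` zeroing the bottom-right `N × F` block. -/
def maskT (n N p F : ℕ) (M : Matrix (Fin n) (Fin p) ℝ) : Matrix (Fin n) (Fin p) ℝ :=
  Matrix.of fun i j => if (i : ℕ) < n - N ∨ (j : ℕ) < p - F then M i j else 0

/-- Cone generated by the rows of `W`. -/
def coneRows {m K : ℕ} (W : Matrix (Fin m) (Fin K) ℝ) : Set (Fin K → ℝ) :=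
  {x | ∃ c : Fin m → ℝ, (∀ i, 0 ≤ c i) ∧ x = ∑ i, c i • W i}

/-- Dual cone of the columns of `H`: `{x | xᵀ H ≥ 0}`. -/
def dualConeCols {K q : ℕ} (H : Matrix (Fin K) (Fin q) ℝ) : Set (Fin K → ℝ) :=
  {x | ∀ j, 0 ≤ ∑ k, x k * H k j}

/-- A `K`-simplicial cone: the cone generated by `K` linearly independent vectors of `ℝ^K`. -/
def IsSimplicialCone {K : ℕ} (C : Set (Fin K → ℝ)) : Prop :=
  ∃ B : Matrix (Fin K) (Fin K) ℝ, LinearIndependent ℝ (fun k => B k) ∧ C = coneRows B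

/-- The nonnegative orthant of `ℝ^K`. -/
def nonnegOrthant (K : ℕ) : Set (Fin K → ℝ) := {x | ∀ k, 0 ≤ x k}

/-- `(W, H) ≡ (W0, H0)`: equality up to permutation and positive scaling of the
columns of `W` (resp. rows of `H`). -/
def EquivScalePerm {n K p : ℕ} (W W0 : Matrix (Fin n) (Fin K) ℝ)
    (H H0 : Matrix (Fin K) (Fin p) ℝ) : Prop :=
  ∃ σ : Equiv.Perm (Fin K), ∃ d : Fin K → ℝ, (∀ k, 0 < d k) ∧
    (∀ i k, W i k = d k * W0 i (σ k)) ∧ (∀ k j, H k j = (d k)⁻¹ * H0 (σ k) j)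

/-- A matrix whose rank equals its number of rows has a right inverse. -/
theorem exists_right_inverse_of_rank_eq {K q : ℕ} {A : Matrix (Fin K) (Fin q) ℝ}
    (hA : A.rank = K) : ∃ S : Matrix (Fin q) (Fin K) ℝ, A * S = 1 := by
  apply Matrix.mulVec_surjective_iff_exists_right_inverse.1
  have htop : LinearMap.range A.mulVecLin = ⊤ :=
    Submodule.eq_top_of_finrank_eq (by simpa [Matrix.rank] using hA)
  exact LinearMap.range_eq_top.1 htop

/-- A matrix whose rank equals its number of columns has a left inverse. -/
theorem exists_left_inverse_of_rank_eq {m K : ℕ} {A : Matrix (Fin m) (Fin K) ℝ}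
    (hA : A.rank = K) : ∃ L : Matrix (Fin K) (Fin m) ℝ, L * A = 1 := by
  obtain ⟨S, hS⟩ := exists_right_inverse_of_rank_eq (A := Aᵀ) (by rw [Matrix.rank_transpose, hA])
  exact ⟨Sᵀ, by simpa using congrArg Matrix.transpose hS⟩

/-- A matrix with linearly independent rows has a right inverse. -/
theorem exists_right_inverse_of_linearIndependent {K q : ℕ} {A : Matrix (Fin K) (Fin q) ℝ}
    (hA : LinearIndependent ℝ (fun k => A k)) :
    ∃ S : Matrix (Fin q) (Fin K) ℝ, A * S = 1 :=
  exists_right_inverse_of_rank_eq (by simpa using LinearIndependent.rank_matrix hA)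

/-- A linear combination of the rows of a matrix is a vector-matrix product. -/
theorem sum_smul_row_eq_vecMul {m K : ℕ} (c : Fin m → ℝ) (A : Matrix (Fin m) (Fin K) ℝ) :
    ∑ i, c i • A i = c ᵥ* A := by
  ext k
  simp [Matrix.vecMul, dotProduct]

/-- The product of a nonnegative vector and a nonnegative matrix is nonnegative. -/
theorem vecMul_nonneg {m K : ℕ} {c : Fin m → ℝ} {A : Matrix (Fin m) (Fin K) ℝ}
    (hc : ∀ i, 0 ≤ c i) (hA : Nonneg A) (k : Fin K) : 0 ≤ (c ᵥ* A) k := by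
  simp only [Matrix.vecMul, dotProduct]
  exact Finset.sum_nonneg fun i _ => mul_nonneg (hc i) (hA i k)

/-- Left multiplication by a nonnegative matrix shrinks the cone generated by the rows. -/
theorem coneRows_mul_subset {m l K : ℕ} {A : Matrix (Fin m) (Fin l) ℝ} (hA : Nonneg A)
    (B : Matrix (Fin l) (Fin K) ℝ) : coneRows (A * B) ⊆ coneRows B := by
  rintro x ⟨c, hc, rfl⟩
  refine ⟨c ᵥ* A, vecMul_nonneg hc hA, ?_⟩
  rw [sum_smul_row_eq_vecMul, sum_smul_row_eq_vecMul, Matrix.vecMul_vecMul]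

/-- If `B * H` is nonnegative, the cone of the rows of `B` lies in the dual cone of the columns
of `H`. -/
theorem coneRows_subset_dualConeCols {m K q : ℕ} {B : Matrix (Fin m) (Fin K) ℝ}
    {H : Matrix (Fin K) (Fin q) ℝ} (h : Nonneg (B * H)) : coneRows B ⊆ dualConeCols H := by
  rintro x ⟨c, hc, rfl⟩ j
  rw [sum_smul_row_eq_vecMul]
  change 0 ≤ ((c ᵥ* B) ᵥ* H) j
  rw [Matrix.vecMul_vecMul]
  exact vecMul_nonneg hc h j

/-- If the rows of an invertible matrix generate the nonnegative orthant, then the matrix and its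
inverse are both nonnegative. -/
theorem nonneg_of_coneRows_eq_nonnegOrthant {K : ℕ} {P Q : Matrix (Fin K) (Fin K) ℝ}
    (hQP : Q * P = 1) (h : coneRows Q = nonnegOrthant K) : Nonneg Q ∧ Nonneg P := by
  constructor
  · intro k
    have hk : Q k ∈ coneRows Q :=
      ⟨Pi.single k 1, fun i => by by_cases hi : i = k <;> simp [hi],
        by rw [sum_smul_row_eq_vecMul, Matrix.single_one_vecMul]; rfl⟩
    rw [h] at hk
    exact hk
  · intro k
    have hk : (Pi.single k 1 : Fin K → ℝ) ∈ nonnegOrthant K := fun i => by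
      by_cases hi : i = k <;> simp [hi]
    rw [← h] at hk
    obtain ⟨c, hc, hck⟩ := hk
    have hcP : P k = c := by
      have := congrArg (fun v => v ᵥ* P) hck
      simpa [sum_smul_row_eq_vecMul, Matrix.vecMul_vecMul, hQP, Matrix.row] using this
    intro i
    rw [hcP]
    exact hc i

/-- A nonnegative matrix with nonnegative inverse is a permuted positive diagonal matrix. -/
theorem exists_perm_of_nonneg_of_mul_eq_one {K : ℕ} {P Q : Matrix (Fin K) (Fin K) ℝ}
    (hQ : Nonneg Q) (hP : Nonneg P) (hPQ : P * Q = 1) (hQP : Q * P = 1) :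
    ∃ σ : Equiv.Perm (Fin K), ∃ d : Fin K → ℝ, (∀ k, 0 < d k) ∧
      (∀ k l, l ≠ σ k → P l k = 0) ∧ (∀ k l, l ≠ σ k → Q k l = 0) ∧
      (∀ k, P (σ k) k = d k) ∧ (∀ k, Q k (σ k) = (d k)⁻¹) := by
  have term_zero : ∀ {A B : Matrix (Fin K) (Fin K) ℝ}, Nonneg A → Nonneg B → A * B = 1 →
      ∀ i j l, i ≠ j → A i l * B l j = 0 := by
    intro A B hA hB hAB i j l hij
    have hsum : ∑ l, A i l * B l j = 0 := by
      rw [← Matrix.mul_apply, hAB, Matrix.one_apply_ne hij]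
    exact (Finset.sum_eq_zero_iff_of_nonneg fun l _ => mul_nonneg (hA i l) (hB l j)).1 hsum l
      (Finset.mem_univ l)
  have hdiag : ∀ k, ∑ l, Q k l * P l k = 1 := fun k => by
    rw [← Matrix.mul_apply, hQP, Matrix.one_apply_eq]
  have hex : ∀ k, ∃ l, Q k l * P l k ≠ 0 := by
    intro k
    by_contra! hzero
    simpa [hzero] using hdiag k
  choose s hs using hex
  have hQs : ∀ k, Q k (s k) ≠ 0 := fun k => left_ne_zero_of_mul (hs k)
  have hPs : ∀ k, P (s k) k ≠ 0 := fun k => right_ne_zero_of_mul (hs k)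
  have hinj : Function.Injective s := by
    intro k k' hkk
    by_contra hne
    have hz := term_zero hQ hP hQP k k' (s k) hne
    rw [mul_eq_zero] at hz
    exact hz.elim (hQs k) (hkk ▸ hPs k')
  have hP0 : ∀ k l, l ≠ s k → P l k = 0 := fun k l hl =>
    (mul_eq_zero.1 (term_zero hP hQ hPQ l (s k) k hl)).resolve_right (hQs k)
  have hQ0 : ∀ k l, l ≠ s k → Q k l = 0 := fun k l hl =>
    (mul_eq_zero.1 (term_zero hP hQ hPQ (s k) l k hl.symm)).resolve_left (hPs k)
  refine ⟨Equiv.ofBijective s (Finite.injective_iff_bijective.1 hinj), fun k => P (s k) k,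
    fun k => lt_of_le_of_ne (hP _ _) (hPs k).symm, hP0, hQ0, fun k => rfl, fun k => ?_⟩
  refine eq_inv_of_mul_eq_one_left ?_
  have hone := hdiag k
  rwa [Finset.sum_eq_single (s k) (fun l _ hl => by rw [hP0 k l hl, mul_zero]) (by simp)] at hone

/-- under condition (A1), partial observation uniqueness (POU) holds. -/
theorem stmt1 {n N p F K : ℕ} (hN : 1 ≤ N) (hn : N < n) (hF : 1 ≤ F) (hp : F < p)
    (W0 : Matrix (Fin n) (Fin K) ℝ) (H0 : Matrix (Fin K) (Fin p) ℝ)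
    (hW0 : Nonneg W0) (hH0 : Nonneg H0)
    (hW0rank : W0.rank = K)
    (hW0trainrank : (W0.submatrix (Fin.castLE (Nat.sub_le n N)) id).rank = K)
    (hH0li : LinearIndependent ℝ (fun k => H0 k))
    (hH0Tli : LinearIndependent ℝ (fun k => (H0.submatrix id (Fin.castLE (Nat.sub_le p F))) k))
    (hA1 : ∀ C : Set (Fin K → ℝ), IsSimplicialCone C →
        ((coneRows (W0.submatrix (Fin.castLE (Nat.sub_le n N)) id) ⊆ C ∧
            C ⊆ dualConeCols H0) ∨
          (coneRows W0 ⊆ C ∧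
            C ⊆ dualConeCols (H0.submatrix id (Fin.castLE (Nat.sub_le p F))))) →
        C = nonnegOrthant K) :
    ∀ (W : Matrix (Fin n) (Fin K) ℝ) (H : Matrix (Fin K) (Fin p) ℝ),
      Nonneg W → Nonneg H → W.rank = K → LinearIndependent ℝ (fun k => H k) →
      maskT n N p F (W * H) = maskT n N p F (W0 * H0) → EquivScalePerm W W0 H H0 := by
  intro W H hW hH _ _ hT
  set e := Fin.castLE (Nat.sub_le n N)
  set f := Fin.castLE (Nat.sub_le p F)
  have htrain : W.submatrix e id * H = W0.submatrix e id * H0 := by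
    ext i j
    have := congrFun (congrFun hT (e i)) j
    simpa [maskT, e, Matrix.mul_apply] using this
  have hobs : W * H.submatrix id f = W0 * H0.submatrix id f := by
    ext i j
    have := congrFun (congrFun hT i) (f j)
    simpa [maskT, f, Matrix.mul_apply] using this
  obtain ⟨L, hL⟩ := exists_left_inverse_of_rank_eq hW0trainrank
  obtain ⟨S, hS⟩ := exists_right_inverse_of_linearIndependent hH0li
  obtain ⟨R, hR⟩ := exists_right_inverse_of_linearIndependent hH0Tli
  obtain ⟨P, hPH⟩ : ∃ P : Matrix (Fin K) (Fin K) ℝ, P * H = H0 :=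
    ⟨L * W.submatrix e id, by rw [Matrix.mul_assoc, htrain, ← Matrix.mul_assoc, hL, Matrix.one_mul]⟩
  obtain ⟨Q, hPQ⟩ : ∃ Q : Matrix (Fin K) (Fin K) ℝ, P * Q = 1 :=
    ⟨H * S, by rw [← Matrix.mul_assoc, hPH, hS]⟩
  have hQP : Q * P = 1 := mul_eq_one_comm.1 hPQ
  have hQH : Q * H0 = H := by rw [← hPH, ← Matrix.mul_assoc, hQP, Matrix.one_mul]
  have hWQ : W * Q = W0 := by
    have hsub : H.submatrix id f = Q * H0.submatrix id f := by
      rw [← hQH]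
      ext k j
      simp [Matrix.mul_apply]
    rw [hsub, ← Matrix.mul_assoc] at hobs
    have := congrArg (· * R) hobs
    simpa only [Matrix.mul_assoc, hR, Matrix.mul_one] using this
  have hW0P : W0 * P = W := by rw [← hWQ, Matrix.mul_assoc, hQP, Matrix.mul_one]
  have hcone : coneRows Q = nonnegOrthant K := by
    refine hA1 _ ⟨Q, Matrix.linearIndependent_rows_iff_isUnit.2 (.of_mul_eq_one P hQP), rfl⟩
      (.inl ⟨?_, coneRows_subset_dualConeCols (hQH ▸ hH)⟩)
    have hsub : W0.submatrix e id = W.submatrix e id * Q := by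
      rw [← hWQ]
      ext i k
      simp [Matrix.mul_apply]
    rw [hsub]
    exact coneRows_mul_subset (fun i k => hW (e i) k) Q
  obtain ⟨hQ, hP⟩ := nonneg_of_coneRows_eq_nonnegOrthant hQP hcone
  obtain ⟨σ, d, hd, hP0, hQ0, hPd, hQd⟩ := exists_perm_of_nonneg_of_mul_eq_one hQ hP hPQ hQP
  refine ⟨σ, d, hd, fun i k => ?_, fun k j => ?_⟩
  · rw [← hW0P, Matrix.mul_apply, Finset.sum_eq_single (σ k)
      (fun l _ hl => by rw [hP0 k l hl, mul_zero]) (by simp), hPd, mul_comm]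
  · rw [← hQH, Matrix.mul_apply, Finset.sum_eq_single (σ k)
      (fun l _ hl => by rw [hQ0 k l hl, zero_mul]) (by simp), hQd]
end
end

section
/- Let X ∈ ℝ^{n×p} and suppose (W, H, N) minimizes (W', H', N') ↦ ‖N' − W' H'‖_F² over the feasible set {(W', H', N') : W' ∈ ℝ^{n×K} row-stochastic, H' ∈ ℝ^{K×p} nonnegative, N' ∈ ℝ^{n×p} with T(N') = X}. Set G := Wᵀ (W H − N) ∈ ℝ^{K×p}. Then G_{kj} ≥ 0 for all k, j, and G_{kj} = 0 whenever H_{kj} > 0 (i.e., H ∘ G = 0 entrywise). -/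
open Matrix

noncomputable section

theorem frobSq_sub_smul {m p : ℕ} (A B : Matrix (Fin m) (Fin p) ℝ) (t : ℝ) :
    frobSq (A - t • B) = frobSq A - 2 * t * (∑ i, ∑ j, A i j * B i j) + t ^ 2 * frobSq B := by
  simp only [frobSq, Finset.mul_sum, ← Finset.sum_sub_distrib, ← Finset.sum_add_distrib,
    Matrix.sub_apply, Matrix.smul_apply, smul_eq_mul]
  exact Finset.sum_congr rfl fun i _ => Finset.sum_congr rfl fun j _ => by ring

theorem sum_mul_mul_single {m K p : ℕ} (A : Matrix (Fin m) (Fin p) ℝ)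
    (W : Matrix (Fin m) (Fin K) ℝ) (k : Fin K) (j : Fin p) :
    ∑ i, ∑ l, A i l * (W * Matrix.single k j (1 : ℝ)) i l = (Wᵀ * A) k j := by
  simp only [Matrix.mul_apply, Matrix.transpose_apply]
  refine Finset.sum_congr rfl fun i _ => ?_
  simp [Matrix.single_apply, ite_and, mul_comm]

theorem frobSq_nonneg {m p : ℕ} (A : Matrix (Fin m) (Fin p) ℝ) : 0 ≤ frobSq A :=
  Finset.sum_nonneg fun _ _ => Finset.sum_nonneg fun _ _ => sq_nonneg _

/-- First-order optimality at `0` of `t ↦ 2 t g + t² s` on `[-h, ∞)`. -/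
theorem first_order_of_quadratic_nonneg {g s h : ℝ} (hs : 0 ≤ s) (hh : 0 ≤ h)
    (hq : ∀ t, -h ≤ t → 0 ≤ 2 * t * g + t ^ 2 * s) : 0 ≤ g ∧ (0 < h → g = 0) := by
  have hg : 0 ≤ g := by
    by_contra! hneg
    set t := -g / (s + 1) with ht
    have htpos : 0 < t := div_pos (by linarith) (by linarith)
    have hts : t * (s + 1) = -g := div_mul_cancel₀ _ (by linarith)
    have := hq t (by linarith)
    nlinarith [mul_pos htpos htpos, mul_pos htpos (neg_pos.2 hneg)]
  refine ⟨hg, fun hpos => le_antisymm ?_ hg⟩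
  by_contra! hgpos
  have hdiv : 0 < g / (s + 1) := div_pos hgpos (by linarith)
  set t := min h (g / (s + 1)) with ht
  have htpos : 0 < t := lt_min hpos hdiv
  have hts : t * (s + 1) ≤ g := (le_div_iff₀ (by linarith)).1 (min_le_right _ _)
  have := hq (-t) (neg_le_neg (min_le_left _ _))
  nlinarith [mul_le_mul_of_nonneg_left hts htpos.le, mul_pos htpos htpos, mul_pos htpos hgpos]

/-- KKT conditions in `H` at a minimizer of mask-NNMF. -/
theorem stmt16 {n N p F K : ℕ} (hN : 1 ≤ N) (hn : N < n) (hF : 1 ≤ F) (hp : F < p)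
    (X : Matrix (Fin n) (Fin p) ℝ)
    (W : Matrix (Fin n) (Fin K) ℝ) (H : Matrix (Fin K) (Fin p) ℝ)
    (Nmat : Matrix (Fin n) (Fin p) ℝ)
    (hW : RowStochastic W) (hH : Nonneg H) (hNfeas : maskT n N p F Nmat = X)
    (hmin : ∀ (W' : Matrix (Fin n) (Fin K) ℝ) (H' : Matrix (Fin K) (Fin p) ℝ)
        (N' : Matrix (Fin n) (Fin p) ℝ),
        RowStochastic W' → Nonneg H' → maskT n N p F N' = X →
        frobSq (Nmat - W * H) ≤ frobSq (N' - W' * H')) :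
    ∀ (k : Fin K) (j : Fin p),
      0 ≤ (Wᵀ * (W * H - Nmat)) k j ∧
      (0 < H k j → (Wᵀ * (W * H - Nmat)) k j = 0) := by
  intro k j
  refine first_order_of_quadratic_nonneg (frobSq_nonneg (W * Matrix.single k j (1 : ℝ)))
    (hH k j) fun t ht => ?_
  have hfeas : Nonneg (H + t • Matrix.single k j (1 : ℝ)) := by
    intro a b
    by_cases hab : k = a ∧ j = b
    · obtain ⟨rfl, rfl⟩ := hab
      simp only [Matrix.add_apply, Matrix.smul_apply, Matrix.single_apply_same, smul_eq_mul]
      linarith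
    · simpa [Matrix.single_apply, hab] using hH a b
  have hle := hmin W _ Nmat hW hfeas hNfeas
  rw [Matrix.mul_add, Matrix.mul_smul, ← sub_sub, frobSq_sub_smul, sum_mul_mul_single] at hle
  rw [← neg_sub Nmat (W * H), Matrix.mul_neg, Matrix.neg_apply]
  linarith
end
end
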